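/- Let d ≥ 1, p ≥ 1, and let μ be a Borel probability measure on ℝ^d with ∫ x dμ(x) = 0 and ∫ ‖x‖^{2p} dμ(x) < ∞. Then W_p(μ * γ, γ) ≤ (K_p / (1 − (1 − 2^{−2p})^{1/p})) · (∫ ‖x‖^{2p} dμ(x))^{1/p}, where K_p = max{1, C_p/2 + 1/3} and C_p = (E_{ξ∼N(0,1)} |ξ|^p)^{1/p}. -/

import Mathlib

open MeasureTheory ProbabilityTheory Real ENNReal RealInnerProductSpace

noncomputable section

/-- The set of couplings of two measures `μ` and `ν`. -/
def couplings {E : Type*} [MeasurableSpace E] (μ ν : Measure E) : Set (Measure (E × E)) :=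
  {τ | τ.map Prod.fst = μ ∧ τ.map Prod.snd = ν}

/-- The Wasserstein-`p` distance, valued in `ℝ≥0∞`:
`W_p(μ,ν) = (inf over couplings τ of ∫ ‖z₁ - z₂‖^p dτ)^{1/p}`. -/
noncomputable def Wp {E : Type*} [MeasurableSpace E] [NormedAddCommGroup E]
    (p : ℝ) (μ ν : Measure E) : ℝ≥0∞ :=
  (⨅ τ ∈ couplings μ ν, ∫⁻ z : E × E, ENNReal.ofReal (‖z.1 - z.2‖ ^ p) ∂τ) ^ (1 / p)

/-- The standard Gaussian measure `N(0, I_d)` on `ℝ^d`. -/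
noncomputable def stdGaussian (d : ℕ) : Measure (EuclideanSpace ℝ (Fin d)) :=
  (Measure.pi fun _ : Fin d => gaussianReal 0 1).map
    ((EuclideanSpace.equiv (Fin d) ℝ).symm : (Fin d → ℝ) → EuclideanSpace ℝ (Fin d))

/-- The Gaussian measure `N(m, I_d)` on `ℝ^d`. -/
noncomputable def gaussianE (d : ℕ) (m : EuclideanSpace ℝ (Fin d)) :
    Measure (EuclideanSpace ℝ (Fin d)) :=
  (stdGaussian d).map (fun x => m + x)

/-- `C_p = (E_{ξ ∼ N(0,1)} |ξ|^p)^{1/p}`. -/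
noncomputable def Cconst (p : ℝ) : ℝ := (∫ ξ : ℝ, |ξ| ^ p ∂(gaussianReal 0 1)) ^ (1 / p)

/-- `K_p = max {1, C_p/2 + 1/3}`. -/
noncomputable def Kconst (p : ℝ) : ℝ := max 1 (Cconst p / 2 + 1 / 3)

/-- The constant `c₄ = (e⁴ - 5)/16`. -/
noncomputable def cFour : ℝ := (Real.exp 4 - 5) / 16

/-- The (second-moment) covariance matrix `∫ x xᵀ dμ` of a (centred) measure on `ℝ^d`. -/
noncomputable def covMat {d : ℕ} (μ : Measure (EuclideanSpace ℝ (Fin d))) :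
    Matrix (Fin d) (Fin d) ℝ :=
  Matrix.of fun i j => ∫ x, x i * x j ∂μ

/-- The Frobenius norm of a matrix. -/
noncomputable def frob {d : ℕ} (A : Matrix (Fin d) (Fin d) ℝ) : ℝ :=
  Real.sqrt (∑ i, ∑ j, (A i j) ^ 2)

/-- `τ₁ = E[‖X‖ 1_{‖X‖ > 1}]`. -/
noncomputable def tailOne {d : ℕ} (μ : Measure (EuclideanSpace ℝ (Fin d))) : ℝ :=
  ∫ x in {x : EuclideanSpace ℝ (Fin d) | 1 < ‖x‖}, ‖x‖ ∂μ

/-- `τ₂ = (E[‖X‖² 1_{‖X‖ > 1}])^{1/2}`. -/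
noncomputable def tailTwo {d : ℕ} (μ : Measure (EuclideanSpace ℝ (Fin d))) : ℝ :=
  Real.sqrt (∫ x in {x : EuclideanSpace ℝ (Fin d) | 1 < ‖x‖}, ‖x‖ ^ 2 ∂μ)

/-- `m = E[X 1_{‖X‖ ≤ 1}]`. -/
noncomputable def truncMean {d : ℕ} (μ : Measure (EuclideanSpace ℝ (Fin d))) :
    EuclideanSpace ℝ (Fin d) :=
  ∫ x in {x : EuclideanSpace ℝ (Fin d) | ‖x‖ ≤ 1}, x ∂μ

/-- `X̃ = X 1_{‖X‖ ≤ 1} - E[X 1_{‖X‖ ≤ 1}]`, as a function of `X`. -/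
noncomputable def truncCentred {d : ℕ} (μ : Measure (EuclideanSpace ℝ (Fin d)))
    (x : EuclideanSpace ℝ (Fin d)) : EuclideanSpace ℝ (Fin d) :=
  (if ‖x‖ ≤ 1 then x else 0) - truncMean μ

/-- `Σ̃ = Cov(X̃) = E[X̃ X̃ᵀ]` (note `X̃` is centred). -/
noncomputable def truncCov {d : ℕ} (μ : Measure (EuclideanSpace ℝ (Fin d))) :
    Matrix (Fin d) (Fin d) ℝ :=
  Matrix.of fun i j => ∫ x, truncCentred μ x i * truncCentred μ x j ∂μ

/-- The chi-squared divergence `χ²(ρ ‖ γ) = ∫ ((dρ/dγ) - 1)² dγ`. -/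
noncomputable def chiSqDiv {E : Type*} [MeasurableSpace E] (ρ γm : Measure E) : ℝ :=
  ∫ x, ((ρ.rnDeriv γm x).toReal - 1) ^ 2 ∂γm

/-- The Kullback–Leibler divergence `KL(ρ ‖ γ) = ∫ log (dρ/dγ) dρ`. -/
noncomputable def klDivReal {E : Type*} [MeasurableSpace E] (ρ γm : Measure E) : ℝ :=
  ∫ x, Real.log ((ρ.rnDeriv γm x).toReal) ∂ρ

/-- The Jacobian matrix `∇φ(x)` of a map `φ : ℝ^d → ℝ^d`, with entry `(i,j)` equal to
`∂φ_i/∂x_j (x)`. -/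
noncomputable def jacobianM {d : ℕ}
    (φ : EuclideanSpace ℝ (Fin d) → EuclideanSpace ℝ (Fin d))
    (x : EuclideanSpace ℝ (Fin d)) : Matrix (Fin d) (Fin d) ℝ :=
  Matrix.of fun i j => fderiv ℝ φ x (EuclideanSpace.single j (1 : ℝ)) i

/-- `τ` is a Stein kernel for the centred measure `ρ` relative to the standard Gaussian:
for all `φ ∈ C_c^∞(ℝ^d; ℝ^d)`, `E⟨X, φ(X)⟩ = E[tr(τ(X) ∇φ(X))]`. -/
def IsSteinKernel {d : ℕ} (ρ : Measure (EuclideanSpace ℝ (Fin d)))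
    (τ : EuclideanSpace ℝ (Fin d) → Matrix (Fin d) (Fin d) ℝ) : Prop :=
  ∀ φ : EuclideanSpace ℝ (Fin d) → EuclideanSpace ℝ (Fin d),
    ContDiff ℝ (⊤ : ℕ∞) φ → HasCompactSupport φ →
      ∫ x, ⟪x, φ x⟫ ∂ρ = ∫ x, Matrix.trace (τ x * jacobianM φ x) ∂ρ

/-- The cumulative distribution function of `N(0,1)`. -/
def gaussCDF (t : ℝ) : ℝ := (gaussianReal 0 1).real (Set.Iic t)

/-- The cumulative distribution function of the mixture `(N(a,1) + N(-a,1)) / 2`. -/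
def mixCDF (a t : ℝ) : ℝ := (gaussCDF (t - a) + gaussCDF (t + a)) / 2

lemma hasDerivAt_gaussCDF (t : ℝ) : HasDerivAt gaussCDF (gaussianPDFReal 0 1 t) t := by
  have hint : Integrable (gaussianPDFReal 0 1) := integrable_gaussianPDFReal 0 1
  have hcont : Continuous (gaussianPDFReal 0 1) := by
    unfold gaussianPDFReal; fun_prop
  have heq : gaussCDF = fun t => gaussCDF 0 + ∫ s in (0 : ℝ)..t, gaussianPDFReal 0 1 s := by
    have h (t : ℝ) : gaussCDF t = ∫ s in Set.Iic t, gaussianPDFReal 0 1 s := by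
      rw [gaussCDF, measureReal_def, gaussianReal_apply_eq_integral 0 one_ne_zero,
        ENNReal.toReal_ofReal]
      exact integral_nonneg fun x => gaussianPDFReal_nonneg 0 1 x
    funext t
    rw [← intervalIntegral.integral_Iic_sub_Iic hint.integrableOn hint.integrableOn, h, h]
    ring
  rw [heq]
  exact (intervalIntegral.integral_hasDerivAt_right (hint.intervalIntegrable)
    (hcont.stronglyMeasurableAtFilter _ _) hcont.continuousAt).const_add _

lemma continuous_gaussCDF : Continuous gaussCDF :=
  continuous_iff_continuousAt.2 fun t => (hasDerivAt_gaussCDF t).continuousAt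

lemma strictMono_gaussCDF : StrictMono gaussCDF :=
  strictMono_of_hasDerivAt_pos hasDerivAt_gaussCDF
    fun t => gaussianPDFReal_pos 0 1 t one_ne_zero

lemma gaussCDF_neg (t : ℝ) : gaussCDF (-t) = 1 - gaussCDF t := by
  have h : (gaussianReal 0 1).real (Set.Iic (-t)) = (gaussianReal 0 1).real (Set.Iio t)ᶜ := by
    have := gaussianReal_map_neg (μ := 0) (v := 1)
    rw [neg_zero] at this
    conv_lhs => rw [← this]
    rw [map_measureReal_apply measurable_neg measurableSet_Iic]
    congr 1
    ext x
    simp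
  have := nullSingletonClass_gaussianReal (μ := 0) (v := 1) one_ne_zero
  rw [gaussCDF, h, probReal_compl_eq_one_sub measurableSet_Iio, gaussCDF,
    measureReal_congr Iio_ae_eq_Iic]

lemma tendsto_gaussCDF_atTop : Filter.Tendsto gaussCDF Filter.atTop (nhds 1) := by
  have h : gaussCDF = cdf (gaussianReal 0 1) := by
    funext t
    rw [cdf_eq_real, gaussCDF]
  rw [h]
  exact tendsto_cdf_atTop _

lemma continuous_mixCDF : Continuous (Function.uncurry mixCDF) := by
  have := continuous_gaussCDF
  unfold mixCDF Function.uncurry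
  fun_prop

lemma strictMono_mixCDF (a : ℝ) : StrictMono (mixCDF a) := by
  intro s t hst
  have h1 := strictMono_gaussCDF (show s - a < t - a by linarith)
  have h2 := strictMono_gaussCDF (show s + a < t + a by linarith)
  unfold mixCDF
  linarith

lemma mixCDF_neg (a t : ℝ) : mixCDF a (-t) = 1 - mixCDF a t := by
  have h1 := gaussCDF_neg (t + a)
  have h2 := gaussCDF_neg (t - a)
  unfold mixCDF
  rw [show -t - a = -(t + a) by ring, show -t + a = -(t - a) by ring, h1, h2]
  ring

lemma exists_mixCDF_eq (a z : ℝ) : ∃ t, |t - z| ≤ |a| ∧ mixCDF a t = gaussCDF z := by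
  have hm := strictMono_gaussCDF.monotone
  have h := intermediate_value_Icc (f := mixCDF a) (a := z - |a|) (b := z + |a|)
    (by linarith [abs_nonneg a])
    (continuous_mixCDF.comp (Continuous.prodMk_right a)).continuousOn
  obtain ⟨t, ht, hte⟩ := h (show gaussCDF z ∈ _ from by
    have h1 := hm (show z - |a| - a ≤ z by linarith [neg_abs_le a])
    have h2 := hm (show z - |a| + a ≤ z by linarith [le_abs_self a])
    have h3 := hm (show z ≤ z + |a| - a by linarith [le_abs_self a])
    have h4 := hm (show z ≤ z + |a| + a by linarith [neg_abs_le a])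
    constructor <;> unfold mixCDF <;> linarith)
  exact ⟨t, abs_le.2 ⟨by linarith [ht.1], by linarith [ht.2]⟩, hte⟩

/-- The monotone transport map from `N(0,1)` to `(N(a,1) + N(-a,1)) / 2`. -/
def mixTransport (a z : ℝ) : ℝ := Classical.choose (exists_mixCDF_eq a z)

lemma abs_mixTransport_sub_le (a z : ℝ) : |mixTransport a z - z| ≤ |a| :=
  (Classical.choose_spec (exists_mixCDF_eq a z)).1

lemma mixCDF_mixTransport (a z : ℝ) : mixCDF a (mixTransport a z) = gaussCDF z :=
  (Classical.choose_spec (exists_mixCDF_eq a z)).2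

lemma mixTransport_le_iff (a z t : ℝ) : mixTransport a z ≤ t ↔ gaussCDF z ≤ mixCDF a t := by
  rw [← mixCDF_mixTransport a z, (strictMono_mixCDF a).le_iff_le]

lemma measurable_mixTransport : Measurable (Function.uncurry mixTransport) := by
  refine measurable_of_Iic fun t => ?_
  have : Function.uncurry mixTransport ⁻¹' Set.Iic t =
      {q : ℝ × ℝ | gaussCDF q.2 ≤ mixCDF q.1 t} := by
    ext q
    exact mixTransport_le_iff q.1 q.2 t
  rw [this]
  refine measurableSet_le (continuous_gaussCDF.comp continuous_snd).measurable ?_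
  exact (continuous_mixCDF.comp (continuous_fst.prodMk continuous_const)).measurable

lemma mixTransport_neg (a z : ℝ) : mixTransport a (-z) = -mixTransport a z := by
  apply (strictMono_mixCDF a).injective
  rw [mixCDF_neg, mixCDF_mixTransport, mixCDF_mixTransport, gaussCDF_neg]

lemma map_mixTransport (a : ℝ) :
    (gaussianReal 0 1).map (mixTransport a) =
      (2⁻¹ : ℝ≥0∞) • (gaussianReal 0 1).map (fun z => z + a) +
        (2⁻¹ : ℝ≥0∞) • (gaussianReal 0 1).map (fun z => z - a) := by
  have hT : Measurable (mixTransport a) :=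
    measurable_mixTransport.comp measurable_prodMk_left
  have := Measure.isProbabilityMeasure_map (μ := gaussianReal 0 1) hT.aemeasurable
  refine Measure.ext_of_Iic _ _ fun t => ?_
  have hG (s : ℝ) : gaussianReal 0 1 (Set.Iic s) = ENNReal.ofReal (gaussCDF s) := by
    rw [gaussCDF, ofReal_measureReal]
  obtain ⟨s, hs⟩ : ∃ s, gaussCDF s = mixCDF a t := by
    have h := mem_range_of_exists_le_of_exists_ge continuous_gaussCDF
      (c := mixCDF a t)
    have hm := strictMono_gaussCDF.monotone
    have h1 := hm (show t - |a| ≤ t - a by linarith [le_abs_self a])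
    have h2 := hm (show t - |a| ≤ t + a by linarith [neg_abs_le a])
    have h3 := hm (show t - a ≤ t + |a| by linarith [neg_abs_le a])
    have h4 := hm (show t + a ≤ t + |a| by linarith [le_abs_self a])
    exact h ⟨t - |a|, by unfold mixCDF; linarith⟩ ⟨t + |a|, by unfold mixCDF; linarith⟩
  have hpre : mixTransport a ⁻¹' Set.Iic t = Set.Iic s := by
    ext z
    simp [mixTransport_le_iff, ← hs, strictMono_gaussCDF.le_iff_le]
  have hn (s : ℝ) : 0 ≤ gaussCDF s := measureReal_nonneg
  have h1 : (fun z => z + a) ⁻¹' Set.Iic t = Set.Iic (t - a) := by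
    ext z; simp [le_sub_iff_add_le]
  have h2 : (fun z => z - a) ⁻¹' Set.Iic t = Set.Iic (t + a) := by
    ext z; simp
  rw [Measure.map_apply hT measurableSet_Iic, hpre, hG, hs, Measure.add_apply,
    Measure.smul_apply, Measure.smul_apply, Measure.map_apply (by fun_prop) measurableSet_Iic,
    Measure.map_apply (by fun_prop) measurableSet_Iic, h1, h2, hG, hG, smul_eq_mul, smul_eq_mul,
    ← mul_add, ← ENNReal.ofReal_add (hn _) (hn _),
    show (2⁻¹ : ℝ≥0∞) = ENNReal.ofReal 2⁻¹ by
      rw [ENNReal.ofReal_inv_of_pos two_pos, ENNReal.ofReal_ofNat],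
    ← ENNReal.ofReal_mul (by norm_num), mixCDF]
  congr 1
  ring

lemma mul_tanh_le_two_log_cosh {x : ℝ} (hx : 0 ≤ x) :
    x * Real.sinh x ≤ 2 * Real.log (Real.cosh x) * Real.cosh x := by
  have hc (y : ℝ) : 0 < Real.cosh y := Real.cosh_pos y
  have hd (y : ℝ) : HasDerivAt
      (fun y => 2 * Real.log (Real.cosh y) - y * (Real.sinh y / Real.cosh y))
      (2 * (Real.sinh y / Real.cosh y) - (1 * (Real.sinh y / Real.cosh y) +
        y * ((Real.cosh y * Real.cosh y - Real.sinh y * Real.sinh y) / Real.cosh y ^ 2))) y :=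
    (((Real.hasDerivAt_cosh y).log (hc y).ne').const_mul 2).sub ((hasDerivAt_id y).mul
      ((Real.hasDerivAt_sinh y).div (Real.hasDerivAt_cosh y) (hc y).ne'))
  have hmono : MonotoneOn
      (fun y => 2 * Real.log (Real.cosh y) - y * (Real.sinh y / Real.cosh y)) (Set.Ici 0) := by
    refine monotoneOn_of_deriv_nonneg (convex_Ici 0)
      (fun y _ => (hd y).continuousAt.continuousWithinAt)
      (fun y _ => (hd y).differentiableAt.differentiableWithinAt) fun y hy => ?_
    rw [interior_Ici] at hy
    have hy : 0 < y := hy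
    rw [(hd y).deriv]
    have h1 : y ≤ Real.sinh y := Real.self_le_sinh_iff.2 hy.le
    have h2 := Real.one_le_cosh y
    have h3 := Real.cosh_sq y
    have h4 : y ≤ Real.sinh y * Real.cosh y := by nlinarith
    have : 2 * (Real.sinh y / Real.cosh y) - (1 * (Real.sinh y / Real.cosh y) +
        y * ((Real.cosh y * Real.cosh y - Real.sinh y * Real.sinh y) / Real.cosh y ^ 2)) =
        (Real.sinh y * Real.cosh y - y) / Real.cosh y ^ 2 := by
      rw [show Real.cosh y * Real.cosh y - Real.sinh y * Real.sinh y = 1 by nlinarith]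
      field_simp [(hc y).ne']
      ring
    rw [this]
    exact div_nonneg (by linarith) (by positivity)
  have h := hmono Set.self_mem_Ici hx hx
  simp only [Real.cosh_zero, Real.log_one, Real.sinh_zero, mul_zero, zero_mul, sub_zero] at h
  have h' : x * (Real.sinh x / Real.cosh x) ≤ 2 * Real.log (Real.cosh x) := by linarith
  rw [← mul_div_assoc, div_le_iff₀ (hc x)] at h'
  exact h'

lemma antitoneOn_log_cosh_div_sq :
    AntitoneOn (fun x : ℝ => Real.log (Real.cosh x) / x ^ 2) (Set.Ioi 0) := by
  have hd (y : ℝ) (hy : 0 < y) : HasDerivAt (fun x : ℝ => Real.log (Real.cosh x) / x ^ 2)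
      ((Real.sinh y / Real.cosh y * y ^ 2 - Real.log (Real.cosh y) * (2 * y)) / (y ^ 2) ^ 2) y := by
    have := ((Real.hasDerivAt_cosh y).log (Real.cosh_pos y).ne').div
      (hasDerivAt_pow 2 y) (by positivity)
    simpa using! this
  refine antitoneOn_of_deriv_nonpos (convex_Ioi 0)
    (fun y hy => (hd y hy).continuousAt.continuousWithinAt)
    (fun y hy => ?_) fun y hy => ?_
  all_goals rw [interior_Ioi] at hy; have hy : 0 < y := hy
  · exact (hd y hy).differentiableAt.differentiableWithinAt
  rw [(hd y hy).deriv]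
  refine div_nonpos_of_nonpos_of_nonneg ?_ (by positivity)
  have h := mul_tanh_le_two_log_cosh hy.le
  have h2 : y * (Real.sinh y / Real.cosh y) ≤ 2 * Real.log (Real.cosh y) := by
    rw [← mul_div_assoc, div_le_iff₀ (Real.cosh_pos y)]
    exact h
  nlinarith

lemma gaussianPDFReal_mul_sub_add (a z : ℝ) :
    Real.exp (a ^ 2 / 2) * ((gaussianPDFReal 0 1 (Real.exp (a ^ 2 / 2) * z - a) +
      gaussianPDFReal 0 1 (Real.exp (a ^ 2 / 2) * z + a)) / 2) =
    gaussianPDFReal 0 1 z * Real.exp (Real.log (Real.cosh (a * Real.exp (a ^ 2 / 2) * z)) -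
      (Real.exp (a ^ 2 / 2) ^ 2 - 1) / 2 * z ^ 2) := by
  set c := Real.exp (a ^ 2 / 2) with hcdef
  rw [Real.exp_sub, Real.exp_log (Real.cosh_pos _), Real.cosh_eq]
  simp only [gaussianPDFReal, sub_zero, NNReal.coe_one, mul_one]
  have e1 : Real.exp (-(c * z - a) ^ 2 / 2) =
      Real.exp (-z ^ 2 / 2) / Real.exp ((c ^ 2 - 1) / 2 * z ^ 2) * Real.exp (a * c * z) / c := by
    rw [hcdef, ← Real.exp_sub, ← Real.exp_add, ← Real.exp_sub, ← hcdef]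
    congr 1; ring
  have e2 : Real.exp (-(c * z + a) ^ 2 / 2) =
      Real.exp (-z ^ 2 / 2) / Real.exp ((c ^ 2 - 1) / 2 * z ^ 2) * Real.exp (-(a * c * z)) / c := by
    rw [hcdef, ← Real.exp_sub, ← Real.exp_add, ← Real.exp_sub, ← hcdef]
    congr 1; ring
  have hc : c ≠ 0 := (Real.exp_pos _).ne'
  rw [e1, e2]
  field_simp

lemma gaussCDF_le_mixCDF_mul {a z : ℝ} (ha : 0 < a) (hz : 0 ≤ z) :
    gaussCDF z ≤ mixCDF a (Real.exp (a ^ 2 / 2) * z) := by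
  set c := Real.exp (a ^ 2 / 2) with hcdef
  have hc : 0 < c := Real.exp_pos _
  set h : ℝ → ℝ := fun z => mixCDF a (c * z) - gaussCDF z with hh
  have hd (y : ℝ) : HasDerivAt h (gaussianPDFReal 0 1 y *
      (Real.exp (Real.log (Real.cosh (a * c * y)) - (c ^ 2 - 1) / 2 * y ^ 2) - 1)) y := by
    have hl : HasDerivAt (fun y => c * y) c y := by
      simpa using! (hasDerivAt_id y).const_mul c
    have h1 := (hasDerivAt_gaussCDF (c * y - a)).comp y (hl.sub_const a)
    have h2 := (hasDerivAt_gaussCDF (c * y + a)).comp y (hl.add_const a)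
    have h3 := ((h1.add h2).div_const 2).sub (hasDerivAt_gaussCDF y)
    refine h3.congr_deriv ?_
    rw [mul_sub, ← gaussianPDFReal_mul_sub_add a y]
    ring
  have h0 : h 0 = 0 := by
    have := gaussCDF_neg a
    have h2 := gaussCDF_neg 0
    rw [neg_zero] at h2
    simp only [hh, mixCDF, mul_zero, zero_sub, zero_add]
    linarith
  have htop : Filter.Tendsto h Filter.atTop (nhds 0) := by
    have hl : Filter.Tendsto (fun y => c * y) Filter.atTop Filter.atTop :=
      Filter.tendsto_id.const_mul_atTop hc
    have h1 := tendsto_gaussCDF_atTop.comp (Filter.tendsto_atTop_add_const_right _ (-a) hl)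
    have h2 := tendsto_gaussCDF_atTop.comp (Filter.tendsto_atTop_add_const_right _ a hl)
    have h3 := ((h1.add h2).div_const 2).sub tendsto_gaussCDF_atTop
    norm_num at h3
    exact h3
  by_contra! hlt
  have hneg : h z < 0 := by simp only [hh]; linarith
  have hz0 : 0 < z := by
    rcases hz.eq_or_lt with rfl | hz0
    · exact absurd h0 hneg.ne
    · exact hz0
  obtain ⟨w, ⟨hw0, hwz⟩, hw⟩ := exists_hasDerivAt_eq_slope h _ hz0
    (fun y _ => (hd y).continuousAt.continuousWithinAt) fun y _ => hd y
  rw [h0, sub_zero, sub_zero] at hw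
  have hφ (y : ℝ) : 0 < gaussianPDFReal 0 1 y := gaussianPDFReal_pos 0 1 y one_ne_zero
  have hklt : Real.log (Real.cosh (a * c * w)) - (c ^ 2 - 1) / 2 * w ^ 2 < 0 := by
    by_contra! hk
    have h1 : 0 ≤ gaussianPDFReal 0 1 w *
        (Real.exp (Real.log (Real.cosh (a * c * w)) - (c ^ 2 - 1) / 2 * w ^ 2) - 1) :=
      mul_nonneg (hφ w).le (by linarith [Real.one_le_exp hk])
    rw [hw] at h1
    exact absurd (div_neg_of_neg_of_pos hneg hz0) (not_lt.2 h1)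
  have hanti : AntitoneOn h (Set.Ici z) := by
    refine antitoneOn_of_deriv_nonpos (convex_Ici z)
      (fun y _ => (hd y).continuousAt.continuousWithinAt)
      (fun y _ => (hd y).differentiableAt.differentiableWithinAt) fun y hy => ?_
    rw [interior_Ici] at hy
    have hwy : w < y := hwz.trans hy
    have hy0 : 0 < y := hw0.trans hwy
    rw [(hd y).deriv]
    refine mul_nonpos_of_nonneg_of_nonpos (hφ y).le ?_
    have hac : 0 < a * c := by positivity
    have hG := antitoneOn_log_cosh_div_sq (show a * c * w ∈ Set.Ioi 0 from by
      simpa using mul_pos hac hw0) (show a * c * y ∈ Set.Ioi 0 from by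
      simpa using mul_pos hac hy0) (by gcongr)
    simp only at hG
    have hG2 : Real.log (Real.cosh (a * c * y)) / (a * c * y) ^ 2 ≤
        ((c ^ 2 - 1) / 2) / (a * c) ^ 2 := by
      refine hG.trans ?_
      rw [mul_pow (a * c), ← div_div, div_right_comm]
      refine div_le_div_of_nonneg_right ?_ (by positivity)
      rw [div_le_iff₀ (by positivity)]
      linarith
    rw [div_le_div_iff₀ (by positivity) (by positivity), mul_pow (a * c) y,
      mul_comm ((a * c) ^ 2) (y ^ 2), ← mul_assoc] at hG2
    have hG3 := le_of_mul_le_mul_right hG2 (by positivity)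
    have := Real.exp_le_one_iff.2 (show Real.log (Real.cosh (a * c * y)) -
      (c ^ 2 - 1) / 2 * y ^ 2 ≤ 0 by linarith)
    linarith
  have hle : ∀ᶠ y in Filter.atTop, h y ≤ h z := by
    filter_upwards [Filter.eventually_ge_atTop z] with y hy
    exact hanti Set.self_mem_Ici hy hy
  exact absurd (le_of_tendsto htop hle) (not_le.2 hneg)

lemma mixCDF_le_gaussCDF {a t : ℝ} (ha : 0 ≤ a) (ht : 0 ≤ t) : mixCDF a t ≤ gaussCDF t := by
  have hd (y : ℝ) : HasDerivAt (fun s => 2 * gaussCDF t - (gaussCDF (t - s) + gaussCDF (t + s)))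
      (gaussianPDFReal 0 1 (t - y) - gaussianPDFReal 0 1 (t + y)) y := by
    have h1 := (hasDerivAt_gaussCDF (t - y)).comp y ((hasDerivAt_id y).const_sub t)
    have h2 := (hasDerivAt_gaussCDF (t + y)).comp y ((hasDerivAt_id y).const_add t)
    refine ((h1.add h2).const_sub (2 * gaussCDF t)).congr_deriv ?_
    ring
  have hmono : MonotoneOn (fun s => 2 * gaussCDF t - (gaussCDF (t - s) + gaussCDF (t + s)))
      (Set.Ici 0) := by
    refine monotoneOn_of_deriv_nonneg (convex_Ici 0)
      (fun y _ => (hd y).continuousAt.continuousWithinAt)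
      (fun y _ => (hd y).differentiableAt.differentiableWithinAt) fun y hy => ?_
    rw [interior_Ici] at hy
    have hy : 0 < y := hy
    rw [(hd y).deriv, sub_nonneg]
    simp only [gaussianPDFReal, sub_zero, NNReal.coe_one, mul_one]
    refine mul_le_mul_of_nonneg_left (Real.exp_le_exp.2 ?_) (by positivity)
    nlinarith [mul_nonneg ht hy.le]
  have h := hmono Set.self_mem_Ici ha ha
  simp only [sub_zero, add_zero] at h
  unfold mixCDF
  linarith

lemma exp_half_sq_bound {a z : ℝ} (ha : 0 < a) (ha1 : a ≤ 1) (hz : 0 ≤ z)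
    (hza : a ^ 2 * (z / 2 + 1 / 3) ≤ a) :
    Real.exp (a ^ 2 / 2) * z - z ≤ a ^ 2 * (z / 2 + 1 / 3) := by
  have hx : |a ^ 2 / 2| ≤ 1 := by
    rw [abs_of_nonneg (by positivity)]; nlinarith
  have h := (abs_le.1 (Real.abs_exp_sub_one_sub_id_le hx)).2
  have hz2 : a * z ≤ 2 - 2 * a / 3 := by
    have : a * (z / 2 + 1 / 3) ≤ 1 := by
      rw [pow_two, mul_assoc] at hza
      nlinarith
    linarith
  have h2 : (a ^ 2 / 2) ^ 2 * z ≤ a ^ 2 / 3 := by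
    have h3 : a ^ 3 / 4 * (a * z) ≤ a ^ 3 / 4 * (2 - 2 * a / 3) := by gcongr
    have h4 : a * (1 / 2 - a / 6) ≤ 1 / 3 := by nlinarith
    have h5 : a ^ 2 * (a * (1 / 2 - a / 6)) ≤ a ^ 2 * (1 / 3) := by gcongr
    nlinarith
  nlinarith [mul_le_mul_of_nonneg_right h hz]

lemma abs_mixTransport_sub_le_sq {a : ℝ} (ha : 0 ≤ a) (ha1 : a ≤ 1) (z : ℝ) :
    |mixTransport a z - z| ≤ a ^ 2 * (|z| / 2 + 1 / 3) := by
  rcases ha.eq_or_lt with rfl | ha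
  · simpa using abs_mixTransport_sub_le 0 z
  have key {z : ℝ} (hz : 0 ≤ z) : |mixTransport a z - z| ≤ a ^ 2 * (z / 2 + 1 / 3) := by
    rcases le_or_gt (a ^ 2 * (z / 2 + 1 / 3)) a with h | h
    · have h1 : z ≤ mixTransport a z := by
        refine (strictMono_mixCDF a).le_iff_le.1 ?_
        rw [mixCDF_mixTransport]
        exact mixCDF_le_gaussCDF ha.le hz
      have h2 := (mixTransport_le_iff a z _).2 (gaussCDF_le_mixCDF_mul ha hz)
      rw [abs_of_nonneg (by linarith)]
      exact (sub_le_sub_right h2 z).trans (exp_half_sq_bound ha ha1 hz h)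
    · exact (abs_mixTransport_sub_le a z).trans (by rw [abs_of_pos ha]; exact h.le)
  rcases le_total 0 z with hz | hz
  · rw [abs_of_nonneg hz]
    exact key hz
  · have := key (neg_nonneg.2 hz)
    rw [mixTransport_neg, ← abs_neg] at this
    rw [abs_of_nonpos hz]
    convert! this using 2
    ring

lemma eLpNorm_id_gaussianReal {p : ℝ} (hp : 1 ≤ p) :
    eLpNorm (fun ξ : ℝ => ξ) (ENNReal.ofReal p) (gaussianReal 0 1) =
      ENNReal.ofReal (Cconst p) := by
  have hp0 : 0 < p := by linarith
  have hm : MemLp (fun ξ : ℝ => ξ) (ENNReal.ofReal p) (gaussianReal 0 1) :=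
    memLp_id_gaussianReal' _ ENNReal.ofReal_ne_top
  rw [hm.eLpNorm_eq_integral_rpow_norm (by simpa using hp0) ENNReal.ofReal_ne_top,
    ENNReal.toReal_ofReal hp0.le, Cconst, one_div]
  rfl

lemma Cconst_nonneg (p : ℝ) : 0 ≤ Cconst p :=
  Real.rpow_nonneg (integral_nonneg fun _ => Real.rpow_nonneg (abs_nonneg _) _) _

lemma one_le_Kconst (p : ℝ) : 1 ≤ Kconst p := le_max_left _ _

lemma eLpNorm_mixTransport_sub_le {p a : ℝ} (hp : 1 ≤ p) (ha : 0 ≤ a) :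
    eLpNorm (fun ξ => mixTransport a ξ - ξ) (ENNReal.ofReal p) (gaussianReal 0 1) ≤
      ENNReal.ofReal (Kconst p * a ^ 2) := by
  have hp1 : 1 ≤ ENNReal.ofReal p := by simpa using hp
  have hp0 : ENNReal.ofReal p ≠ 0 := (one_pos.trans_le hp1).ne'
  have hconst {c : ℝ} (hc : 0 ≤ c) :
      eLpNorm (fun _ : ℝ => c) (ENNReal.ofReal p) (gaussianReal 0 1) = ENNReal.ofReal c := by
    rw [eLpNorm_const c hp0 (NeZero.ne _), measure_univ, ENNReal.one_rpow, mul_one,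
      Real.enorm_eq_ofReal hc]
  have hs (c : ℝ) : eLpNorm (fun ξ : ℝ => c • |ξ|) (ENNReal.ofReal p) (gaussianReal 0 1) =
      ‖c‖ₑ * ENNReal.ofReal (Cconst p) := by
    rw [← eLpNorm_id_gaussianReal hp, ← eLpNorm_norm (fun ξ : ℝ => ξ)]
    exact eLpNorm_const_smul c (fun ξ : ℝ => |ξ|) _ _
  rcases le_total a 1 with h1 | h1
  · calc
      _ ≤ eLpNorm ((fun ξ : ℝ => (a ^ 2 / 2) • |ξ|) + fun _ => a ^ 2 / 3) (ENNReal.ofReal p)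
          (gaussianReal 0 1) := by
        refine eLpNorm_mono_real fun ξ => ?_
        refine (abs_mixTransport_sub_le_sq ha h1 ξ).trans_eq ?_
        simp only [Pi.add_apply, smul_eq_mul]
        ring
      _ ≤ eLpNorm (fun ξ : ℝ => (a ^ 2 / 2) • |ξ|) (ENNReal.ofReal p) (gaussianReal 0 1) +
          eLpNorm (fun _ : ℝ => a ^ 2 / 3) (ENNReal.ofReal p) (gaussianReal 0 1) :=
        eLpNorm_add_le (by fun_prop) (by fun_prop) hp1
      _ = ENNReal.ofReal (a ^ 2 / 2) * ENNReal.ofReal (Cconst p) + ENNReal.ofReal (a ^ 2 / 3) := by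
        rw [hconst (by positivity), hs, Real.enorm_eq_ofReal (by positivity)]
      _ ≤ _ := by
        have := Cconst_nonneg p
        rw [← ENNReal.ofReal_mul (by positivity),
          ← ENNReal.ofReal_add (by positivity) (by positivity)]
        refine ENNReal.ofReal_le_ofReal ?_
        have : Cconst p / 2 + 1 / 3 ≤ Kconst p := le_max_right _ _
        nlinarith [mul_le_mul_of_nonneg_right this (sq_nonneg a)]
  · rw [← hconst (c := Kconst p * a ^ 2) (by have := one_le_Kconst p; positivity)]
    refine eLpNorm_mono_real fun ξ => (abs_mixTransport_sub_le a ξ).trans ?_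
    rw [abs_of_nonneg ha]
    nlinarith [mul_le_mul_of_nonneg_right (one_le_Kconst p) (sq_nonneg a)]

lemma lintegral_mixTransport_sub_le {p a : ℝ} (hp : 1 ≤ p) (ha : 0 ≤ a) :
    ∫⁻ ξ, ‖mixTransport a ξ - ξ‖ₑ ^ p ∂gaussianReal 0 1 ≤
      ENNReal.ofReal (Kconst p ^ p * a ^ (2 * p)) := by
  have hp0 : 0 < p := by linarith
  have hK := one_le_Kconst p
  have h := eLpNorm_mixTransport_sub_le hp ha
  rw [eLpNorm_eq_lintegral_rpow_enorm_toReal (by simpa using hp0) ENNReal.ofReal_ne_top,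
    ENNReal.toReal_ofReal hp0.le, one_div, ENNReal.rpow_inv_le_iff hp0,
    ENNReal.ofReal_rpow_of_nonneg (by positivity) hp0.le,
    Real.mul_rpow (by positivity) (by positivity), ← Real.rpow_natCast_mul ha] at h
  exact_mod_cast h

section Coupling

variable {E : Type*} [NormedAddCommGroup E] [MeasurableSpace E]

/-- There is a coupling of `μ` and `ν` whose `L^p` transport cost is at most `B`. -/
def HasCouplingLE (p : ℝ) (μ ν : Measure E) (B : ℝ≥0∞) : Prop :=
  ∃ τ ∈ couplings μ ν, eLpNorm (fun z : E × E => z.1 - z.2) (ENNReal.ofReal p) τ ≤ B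

lemma HasCouplingLE.Wp_le {p : ℝ} (hp : 0 < p) {μ ν : Measure E} {B : ℝ≥0∞}
    (h : HasCouplingLE p μ ν B) : Wp p μ ν ≤ B := by
  obtain ⟨τ, hτ, hB⟩ := h
  refine le_trans ?_ hB
  rw [eLpNorm_eq_lintegral_rpow_enorm_toReal (by simpa using hp) ENNReal.ofReal_ne_top,
    ENNReal.toReal_ofReal hp.le, Wp]
  refine ENNReal.rpow_le_rpow ((iInf₂_le τ hτ).trans_eq ?_) (by positivity)
  simp_rw [← ENNReal.ofReal_rpow_of_nonneg (norm_nonneg _) hp.le, ofReal_norm]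

lemma HasCouplingLE.mono {p : ℝ} {μ ν : Measure E} {B B' : ℝ≥0∞}
    (h : HasCouplingLE p μ ν B) (hB : B ≤ B') : HasCouplingLE p μ ν B' := by
  obtain ⟨τ, hτ, hle⟩ := h
  exact ⟨τ, hτ, hle.trans hB⟩

/-- Gluing two couplings along their common marginal. -/
lemma HasCouplingLE.trans [BorelSpace E] [SecondCountableTopology E] [CompleteSpace E]
    {p : ℝ} (hp : 1 ≤ p) {μ ν ρ : Measure E} [IsFiniteMeasure μ] [IsFiniteMeasure ν]
    {B B' : ℝ≥0∞} (h : HasCouplingLE p μ ν B) (h' : HasCouplingLE p ν ρ B') :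
    HasCouplingLE p μ ρ (B + B') := by
  obtain ⟨τ, ⟨hτ1, hτ2⟩, hB⟩ := h
  obtain ⟨σ, ⟨hσ1, hσ2⟩, hB'⟩ := h'
  have : Nonempty E := ⟨0⟩
  have : IsFiniteMeasure τ := by
    constructor
    have h := measure_lt_top μ Set.univ
    rwa [← hτ1, Measure.map_apply measurable_fst MeasurableSet.univ, Set.preimage_univ] at h
  have : IsFiniteMeasure σ := by
    constructor
    have h := measure_lt_top ν Set.univ
    rwa [← hσ1, Measure.map_apply measurable_fst MeasurableSet.univ, Set.preimage_univ] at h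
  set κ : Kernel (E × E) E := σ.condKernel.comap Prod.snd measurable_snd with hκ
  set ϖ : Measure ((E × E) × E) := τ ⊗ₘ κ with hϖ
  have hϖ1 : ϖ.map Prod.fst = τ := Measure.fst_compProd τ κ
  have hϖ2 : ϖ.map (fun q : (E × E) × E => (q.1.2, q.2)) = σ := by
    conv_rhs => rw [← σ.disintegrate σ.condKernel]
    have hσf : σ.fst = τ.map Prod.snd := by rw [hτ2]; exact hσ1
    refine Measure.ext_of_lintegral _ fun f hf => ?_
    rw [lintegral_map hf (by fun_prop), hϖ, Measure.lintegral_compProd (by fun_prop),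
      Measure.lintegral_compProd hf, hσf, lintegral_map ?_ measurable_snd]
    · simp [hκ, Kernel.comap_apply]
    · exact Measurable.lintegral_kernel_prod_right' hf
  refine ⟨ϖ.map (fun q : (E × E) × E => (q.1.1, q.2)), ⟨?_, ?_⟩, ?_⟩
  · rw [Measure.map_map (by fun_prop) (by fun_prop), ← hτ1, ← hϖ1,
      Measure.map_map (by fun_prop) (by fun_prop)]
    rfl
  · rw [Measure.map_map (by fun_prop) (by fun_prop), ← hσ2, ← hϖ2,
      Measure.map_map (by fun_prop) (by fun_prop)]
    rfl
  · have hms : AEStronglyMeasurable (fun z : E × E => z.1 - z.2) σ := by fun_prop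
    have hmt : AEStronglyMeasurable (fun z : E × E => z.1 - z.2) τ := by fun_prop
    rw [← hϖ1, eLpNorm_map_measure (by fun_prop) (by fun_prop)] at hB
    rw [← hϖ2, eLpNorm_map_measure (by fun_prop) (by fun_prop)] at hB'
    rw [eLpNorm_map_measure (by fun_prop) (by fun_prop)]
    refine le_trans (le_trans (le_of_eq ?_) (eLpNorm_add_le
      (f := (fun z : E × E => z.1 - z.2) ∘ Prod.fst)
      (g := (fun z : E × E => z.1 - z.2) ∘ fun q : (E × E) × E => (q.1.2, q.2))
      ?_ ?_ (by simpa using hp))) (add_le_add hB hB')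
    · congr 1
      funext q
      simp
    · exact Measurable.aestronglyMeasurable (by fun_prop)
    · exact Measurable.aestronglyMeasurable (by fun_prop)

end Coupling

section GaussianCoupling

variable {E : Type*} [NormedAddCommGroup E] [InnerProductSpace ℝ E] [FiniteDimensional ℝ E]
  [MeasurableSpace E] [BorelSpace E]

/-- Replace the component of `z` along `u` by `s`. -/
def replaceComponent (u : E) (s : ℝ) (z : E) : E := s • u + (z - inner ℝ u z • u)

@[fun_prop]
lemma measurable_replaceComponent {α : Type*} [MeasurableSpace α] {u z : α → E} {s : α → ℝ}
    (hu : Measurable u) (hs : Measurable s) (hz : Measurable z) :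
    Measurable fun x => replaceComponent (u x) (s x) (z x) := by
  unfold replaceComponent
  fun_prop

lemma map_replaceComponent (u : E) (hu : u = 0 ∨ ‖u‖ = 1) :
    ((gaussianReal 0 1).prod (ProbabilityTheory.stdGaussian E)).map
      (fun q => replaceComponent u q.1 q.2) = ProbabilityTheory.stdGaussian E := by
  have hmeas : Measurable fun q : ℝ × E => replaceComponent u q.1 q.2 := by fun_prop
  have := Measure.isProbabilityMeasure_map
    (μ := (gaussianReal 0 1).prod (ProbabilityTheory.stdGaussian E)) hmeas.aemeasurable
  refine Measure.ext_of_charFun ?_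
  ext t
  rw [charFun_apply, integral_map hmeas.aemeasurable (by fun_prop)]
  have hfac (q : ℝ × E) : Complex.exp ((inner ℝ (replaceComponent u q.1 q.2) t : ℝ) * Complex.I) =
      Complex.exp ((inner ℝ q.1 (inner ℝ u t) : ℝ) * Complex.I) *
        Complex.exp ((inner ℝ q.2 (t - inner ℝ u t • u) : ℝ) * Complex.I) := by
    rw [← Complex.exp_add, ← add_mul, ← Complex.ofReal_add]
    congr 3
    simp only [replaceComponent, inner_add_left, inner_sub_left, inner_sub_right,
      real_inner_smul_left, real_inner_smul_right, real_inner_comm u q.2, RCLike.inner_apply,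
      conj_trivial]
    ring
  simp_rw [hfac]
  rw [integral_prod_mul (fun s : ℝ => Complex.exp ((inner ℝ s (inner ℝ u t) : ℝ) * Complex.I))
    (fun z : E => Complex.exp ((inner ℝ z (t - inner ℝ u t • u) : ℝ) * Complex.I)),
    ← charFun_apply, ← charFun_apply, charFun_gaussianReal, charFun_stdGaussian,
    charFun_stdGaussian, ← Complex.exp_add]
  congr 1
  have hn : inner ℝ u t ^ 2 + ‖t - inner ℝ u t • u‖ ^ 2 = ‖t‖ ^ 2 := by
    rcases hu with rfl | hu
    · simp
    · rw [norm_sub_sq_real, norm_smul, hu, real_inner_smul_right, real_inner_comm,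
        Real.norm_eq_abs, mul_one, sq_abs]
      ring
  rw [← Complex.ofReal_pow ‖t‖, ← hn]
  push_cast
  simp
  ring

lemma lintegral_replaceComponent_mixTransport {u : E} (hu : u = 0 ∨ ‖u‖ = 1) (a : ℝ)
    {f : E → ℝ≥0∞} (hf : Measurable f) :
    ∫⁻ q, f (replaceComponent u (mixTransport a q.1) q.2)
      ∂(gaussianReal 0 1).prod (ProbabilityTheory.stdGaussian E) =
    2⁻¹ * ∫⁻ z, f (z + a • u) ∂ProbabilityTheory.stdGaussian E +
      2⁻¹ * ∫⁻ z, f (z - a • u) ∂ProbabilityTheory.stdGaussian E := by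
  have hT : Measurable (mixTransport a) := measurable_mixTransport.comp measurable_prodMk_left
  have h1 (b : ℝ) : ∫⁻ z, f (z + b • u) ∂ProbabilityTheory.stdGaussian E =
      ∫⁻ z, ∫⁻ s, f (replaceComponent u (s + b) z) ∂gaussianReal 0 1
        ∂ProbabilityTheory.stdGaussian E := by
    rw [← lintegral_prod_symm' (fun q : ℝ × E => f (replaceComponent u (q.1 + b) q.2))
      (by fun_prop), ← map_replaceComponent u hu, lintegral_map (by fun_prop) (by fun_prop),
      map_replaceComponent u hu]
    refine lintegral_congr fun q => ?_
    congr 1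
    simp only [replaceComponent, add_smul]
    abel
  have h2 := h1 (-a)
  simp only [neg_smul, ← sub_eq_add_neg] at h2
  rw [h1 a, h2, lintegral_prod_symm' _ (by fun_prop), ← lintegral_const_mul _ (by fun_prop),
    ← lintegral_const_mul _ (by fun_prop), ← lintegral_add_left (by fun_prop)]
  refine lintegral_congr fun z => ?_
  have hg : Measurable fun s => f (replaceComponent u s z) := by fun_prop
  rw [← lintegral_map hg hT, map_mixTransport, lintegral_add_measure, lintegral_smul_measure,
    lintegral_smul_measure, lintegral_map hg (by fun_prop), lintegral_map hg (by fun_prop)]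
  rfl

/-- After convolution with the Gaussian, the law `μ` is coupled to the law of the midpoint of two
independent samples of `μ`, by the one-dimensional transport along their half-difference. -/
lemma hasCouplingLE_midpoint {p : ℝ} (hp : 1 ≤ p) (μ : Measure E) [IsProbabilityMeasure μ]
    (hmom : Integrable (fun q : E × E => ‖(1 / 2 : ℝ) • (q.1 - q.2)‖ ^ (2 * p)) (μ.prod μ)) :
    HasCouplingLE p (μ ∗ ProbabilityTheory.stdGaussian E)
      ((μ.prod μ).map (fun q => (1 / 2 : ℝ) • (q.1 + q.2)) ∗ ProbabilityTheory.stdGaussian E)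
      (ENNReal.ofReal (Kconst p *
        (∫ q, ‖(1 / 2 : ℝ) • (q.1 - q.2)‖ ^ (2 * p) ∂μ.prod μ) ^ (1 / p))) := by
  have hp0 : 0 < p := by linarith
  have hK := one_le_Kconst p
  set γ := ProbabilityTheory.stdGaussian E with hγ
  set S : E × E → E := fun q => (1 / 2 : ℝ) • (q.1 + q.2) with hS
  set D : E × E → E := fun q => (1 / 2 : ℝ) • (q.1 - q.2) with hD
  set u : E × E → E := fun q => ‖D q‖⁻¹ • D q with hu
  have hSm : Measurable S := by fun_prop
  have hDm : Measurable D := by fun_prop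
  have hum : Measurable u := by fun_prop
  have hu1 (q : E × E) : u q = 0 ∨ ‖u q‖ = 1 := by
    by_cases h : D q = 0
    · left; simp [hu, h]
    · right; simp [hu, norm_smul, h]
  have hDu (q : E × E) : ‖D q‖ • u q = D q := by
    by_cases h : D q = 0
    · simp [h]
    · simp [hu, smul_smul, h]
  set P : Measure ((E × E) × (ℝ × E)) := (μ.prod μ).prod ((gaussianReal 0 1).prod γ) with hP
  have hTm : Measurable fun w : (E × E) × (ℝ × E) => mixTransport ‖D w.1‖ w.2.1 :=
    measurable_mixTransport.comp
      (((hDm.comp measurable_fst).norm).prodMk (measurable_fst.comp measurable_snd))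
  set X : (E × E) × (ℝ × E) → E := fun w =>
    S w.1 + replaceComponent (u w.1) (mixTransport ‖D w.1‖ w.2.1) w.2.2 with hX
  set Y : (E × E) × (ℝ × E) → E := fun w =>
    S w.1 + replaceComponent (u w.1) w.2.1 w.2.2 with hY
  have hXm : Measurable X := by fun_prop
  have hYm : Measurable Y := by fun_prop
  refine ⟨P.map fun w => (X w, Y w), ⟨?_, ?_⟩, ?_⟩
  · rw [Measure.map_map measurable_fst (hXm.prodMk hYm)]
    change P.map X = _
    refine Measure.ext_of_lintegral _ fun f hf => ?_
    rw [lintegral_map hf hXm, hP, lintegral_prod _ (by fun_prop), Measure.lintegral_conv hf]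
    have hin (q : E × E) : ∫⁻ v, f (X (q, v)) ∂(gaussianReal 0 1).prod γ =
        2⁻¹ * ∫⁻ z, f (q.1 + z) ∂γ + 2⁻¹ * ∫⁻ z, f (q.2 + z) ∂γ := by
      have := lintegral_replaceComponent_mixTransport (hu1 q) ‖D q‖
        (f := fun z => f (S q + z)) (by fun_prop)
      refine this.trans ?_
      have e1 : S q + D q = q.1 := by simp only [hS, hD]; module
      have e2 : S q - D q = q.2 := by simp only [hS, hD]; module
      congr 2
      · refine lintegral_congr fun z => ?_
        rw [hDu, add_comm z, ← add_assoc, e1]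
      · refine lintegral_congr fun z => ?_
        rw [hDu, sub_eq_add_neg, add_comm z, ← add_assoc, ← sub_eq_add_neg, e2]
    simp_rw [hin]
    have hF : Measurable fun x => ∫⁻ z, f (x + z) ∂γ :=
      Measurable.lintegral_prod_right' (f := fun q : E × E => f (q.1 + q.2)) (by fun_prop)
    rw [lintegral_add_left (by fun_prop), lintegral_const_mul _ (by fun_prop),
      lintegral_const_mul _ (by fun_prop), lintegral_prod _ (by fun_prop),
      lintegral_prod_symm _ (by fun_prop)]
    simp only [lintegral_const, measure_univ, mul_one]
    rw [← add_mul, ENNReal.inv_two_add_inv_two, one_mul]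
  · rw [Measure.map_map measurable_snd (hXm.prodMk hYm)]
    change P.map Y = _
    refine Measure.ext_of_lintegral _ fun f hf => ?_
    have hF : Measurable fun x => ∫⁻ z, f (x + z) ∂γ :=
      Measurable.lintegral_prod_right' (f := fun q : E × E => f (q.1 + q.2)) (by fun_prop)
    rw [lintegral_map hf hYm, hP, lintegral_prod _ (by fun_prop), Measure.lintegral_conv hf,
      lintegral_map hF hSm]
    refine lintegral_congr fun q => ?_
    conv_rhs => rw [hγ, ← map_replaceComponent (u q) (hu1 q)]
    rw [lintegral_map (by fun_prop) (by fun_prop)]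
  · rw [eLpNorm_map_measure (by fun_prop) (by fun_prop),
      eLpNorm_eq_lintegral_rpow_enorm_toReal (by simpa using hp0) ENNReal.ofReal_ne_top,
      ENNReal.toReal_ofReal hp0.le, one_div, ENNReal.rpow_inv_le_iff hp0]
    have hI : 0 ≤ ∫ q, ‖D q‖ ^ (2 * p) ∂μ.prod μ := integral_nonneg fun q => by positivity
    rw [ENNReal.ofReal_rpow_of_nonneg (by positivity) hp0.le,
      Real.mul_rpow (by positivity) (by positivity), Real.rpow_inv_rpow hI hp0.ne']
    rw [ENNReal.ofReal_mul (by positivity), ofReal_integral_eq_lintegral_ofReal hmom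
      (Filter.Eventually.of_forall fun q => by positivity), ← lintegral_const_mul _ (by fun_prop)]
    rw [hP, lintegral_prod _ (by fun_prop)]
    refine lintegral_mono fun q => ?_
    rw [← ENNReal.ofReal_mul (by positivity)]
    refine le_trans ?_ (lintegral_mixTransport_sub_le hp (norm_nonneg (D q)))
    have hqm : Measurable (mixTransport ‖D q‖) :=
      measurable_mixTransport.comp measurable_prodMk_left
    have hfst : ∫⁻ ξ, ‖mixTransport ‖D q‖ ξ - ξ‖ₑ ^ p ∂gaussianReal 0 1 =
        ∫⁻ v, ‖mixTransport ‖D q‖ v.1 - v.1‖ₑ ^ p ∂(gaussianReal 0 1).prod γ := by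
      rw [lintegral_prod _ (by fun_prop)]
      simp
    rw [hfst]
    refine lintegral_mono fun v => ?_
    refine ENNReal.rpow_le_rpow ?_ hp0.le
    have hdiff : X (q, v) - Y (q, v) = (mixTransport ‖D q‖ v.1 - v.1) • u q := by
      simp only [hX, hY, replaceComponent, sub_smul]
      abel
    simp only [Function.comp_apply]
    rw [hdiff, enorm_smul]
    refine mul_le_of_le_one_right' ?_
    rcases hu1 q with h | h
    · simp [h]
    · rw [← ofReal_norm, h, ENNReal.ofReal_one]

end GaussianCoupling

lemma norm_rpow_half_add_sub_le {E : Type*} [NormedAddCommGroup E] [InnerProductSpace ℝ E]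
    {p : ℝ} (hp : 1 ≤ p) (x y : E) :
    ‖(1 / 2 : ℝ) • (x + y)‖ ^ (2 * p) + ‖(1 / 2 : ℝ) • (x - y)‖ ^ (2 * p) ≤
      (‖x‖ ^ (2 * p) + ‖y‖ ^ (2 * p)) / 2 := by
  have hsq (v : E) : ‖v‖ ^ (2 * p) = (‖v‖ ^ 2) ^ p := by
    rw [Real.rpow_mul (norm_nonneg v), Real.rpow_two]
  have hpar : ‖(1 / 2 : ℝ) • (x + y)‖ ^ 2 + ‖(1 / 2 : ℝ) • (x - y)‖ ^ 2 =
      (1 / 2) * ‖x‖ ^ 2 + (1 / 2) * ‖y‖ ^ 2 := by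
    rw [norm_smul, norm_smul, mul_pow, mul_pow, norm_add_sq_real, norm_sub_sq_real]
    norm_num
    ring
  simp_rw [hsq]
  calc
    _ ≤ (‖(1 / 2 : ℝ) • (x + y)‖ ^ 2 + ‖(1 / 2 : ℝ) • (x - y)‖ ^ 2) ^ p :=
      Real.add_rpow_le_rpow_add (by positivity) (by positivity) hp
    _ = ((1 / 2) * ‖x‖ ^ 2 + (1 / 2) * ‖y‖ ^ 2) ^ p := by rw [hpar]
    _ ≤ (1 / 2) * (‖x‖ ^ 2) ^ p + (1 / 2) * (‖y‖ ^ 2) ^ p :=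
      (convexOn_rpow hp).2 (Set.mem_Ici.2 (by positivity)) (Set.mem_Ici.2 (by positivity))
        (by norm_num) (by norm_num) (by norm_num)
    _ = _ := by ring

section Moments

variable {E : Type*} [NormedAddCommGroup E] [InnerProductSpace ℝ E] [FiniteDimensional ℝ E]
  [MeasurableSpace E] [BorelSpace E] {μ : Measure E} [IsProbabilityMeasure μ] {p : ℝ}

lemma memLp_of_integrable_norm_rpow {μ : Measure E} (hp : 1 ≤ p)
    (hmom : Integrable (fun x => ‖x‖ ^ (2 * p)) μ) :
    MemLp (fun x : E => x) (ENNReal.ofReal (2 * p)) μ := by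
  have h := integrable_norm_rpow_iff (μ := μ) (f := fun x : E => x) (p := ENNReal.ofReal (2 * p))
    (by fun_prop) (by simp; linarith) ENNReal.ofReal_ne_top
  rw [ENNReal.toReal_ofReal (by linarith)] at h
  exact h.1 hmom

lemma integrable_id_of_integrable_norm_rpow (hp : 1 ≤ p)
    (hmom : Integrable (fun x => ‖x‖ ^ (2 * p)) μ) : Integrable (fun x : E => x) μ :=
  (memLp_of_integrable_norm_rpow hp hmom).integrable (by
    rw [ENNReal.one_le_ofReal]; linarith)

lemma integrable_half_sum_norm_rpow (hmom : Integrable (fun x => ‖x‖ ^ (2 * p)) μ) :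
    Integrable (fun q : E × E => (‖q.1‖ ^ (2 * p) + ‖q.2‖ ^ (2 * p)) / 2) (μ.prod μ) :=
  ((hmom.comp_fst μ).add (hmom.comp_snd μ)).div_const 2

lemma integrable_half_sub_norm_rpow (hp : 1 ≤ p)
    (hmom : Integrable (fun x => ‖x‖ ^ (2 * p)) μ) :
    Integrable (fun q : E × E => ‖(1 / 2 : ℝ) • (q.1 - q.2)‖ ^ (2 * p)) (μ.prod μ) := by
  refine (integrable_half_sum_norm_rpow hmom).mono'
    (Measurable.aestronglyMeasurable (by fun_prop)) (Filter.Eventually.of_forall fun q => ?_)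
  rw [Real.norm_of_nonneg (by positivity)]
  have := norm_rpow_half_add_sub_le hp q.1 q.2
  have : 0 ≤ ‖(1 / 2 : ℝ) • (q.1 + q.2)‖ ^ (2 * p) := by positivity
  linarith

lemma integrable_half_add_norm_rpow (hp : 1 ≤ p)
    (hmom : Integrable (fun x => ‖x‖ ^ (2 * p)) μ) :
    Integrable (fun q : E × E => ‖(1 / 2 : ℝ) • (q.1 + q.2)‖ ^ (2 * p)) (μ.prod μ) := by
  refine (integrable_half_sum_norm_rpow hmom).mono'
    (Measurable.aestronglyMeasurable (by fun_prop)) (Filter.Eventually.of_forall fun q => ?_)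
  rw [Real.norm_of_nonneg (by positivity)]
  have := norm_rpow_half_add_sub_le hp q.1 q.2
  have : 0 ≤ ‖(1 / 2 : ℝ) • (q.1 - q.2)‖ ^ (2 * p) := by positivity
  linarith

lemma integral_half_add_add_half_sub_le (hp : 1 ≤ p)
    (hmom : Integrable (fun x => ‖x‖ ^ (2 * p)) μ) :
    ∫ q : E × E, ‖(1 / 2 : ℝ) • (q.1 + q.2)‖ ^ (2 * p) ∂μ.prod μ +
      ∫ q : E × E, ‖(1 / 2 : ℝ) • (q.1 - q.2)‖ ^ (2 * p) ∂μ.prod μ ≤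
        ∫ x, ‖x‖ ^ (2 * p) ∂μ := by
  rw [← integral_add (integrable_half_add_norm_rpow hp hmom)
    (integrable_half_sub_norm_rpow hp hmom)]
  refine (integral_mono ((integrable_half_add_norm_rpow hp hmom).add
    (integrable_half_sub_norm_rpow hp hmom)) (integrable_half_sum_norm_rpow hmom)
    fun q => norm_rpow_half_add_sub_le hp q.1 q.2).trans_eq ?_
  rw [integral_div, integral_add (hmom.comp_fst μ) (hmom.comp_snd μ),
    integral_fun_fst (fun x : E => ‖x‖ ^ (2 * p)), integral_fun_snd (fun x : E => ‖x‖ ^ (2 * p))]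
  simp

lemma le_integral_half_sub (hp : 1 ≤ p) (hmean : ∫ x, x ∂μ = 0)
    (hmom : Integrable (fun x => ‖x‖ ^ (2 * p)) μ) :
    (2 : ℝ) ^ (-(2 * p)) * ∫ x, ‖x‖ ^ (2 * p) ∂μ ≤
      ∫ q : E × E, ‖(1 / 2 : ℝ) • (q.1 - q.2)‖ ^ (2 * p) ∂μ.prod μ := by
  have hD := integrable_half_sub_norm_rpow hp hmom
  have hid := integrable_id_of_integrable_norm_rpow hp hmom
  rw [integral_prod _ hD, ← integral_const_mul]
  refine integral_mono_ae (hmom.const_mul _) hD.integral_prod_left ?_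
  filter_upwards [hD.prod_right_ae] with x hx
  have hint : Integrable (fun y => (1 / 2 : ℝ) • (x - y)) μ :=
    ((integrable_const x).sub hid).smul (1 / 2 : ℝ)
  have hxe : (1 / 2 : ℝ) • x = ∫ y, (1 / 2 : ℝ) • (x - y) ∂μ := by
    rw [integral_smul, integral_sub (integrable_const x) hid, hmean]
    simp
  have hn : ‖(1 / 2 : ℝ) • x‖ ≤ ∫ y, ‖(1 / 2 : ℝ) • (x - y)‖ ∂μ := by
    rw [hxe]
    exact norm_integral_le_integral_norm _
  have hJ := (convexOn_rpow (show (1 : ℝ) ≤ 2 * p by linarith)).map_integral_le (μ := μ)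
    (f := fun y => ‖(1 / 2 : ℝ) • (x - y)‖)
    (continuousOn_id.rpow_const fun _ _ => Or.inr (by linarith)) isClosed_Ici
    (Filter.Eventually.of_forall fun y => norm_nonneg _) hint.norm hx
  refine le_trans ?_ ((Real.rpow_le_rpow (norm_nonneg _) hn (by linarith)).trans hJ)
  rw [norm_smul, Real.mul_rpow (norm_nonneg _) (norm_nonneg _), Real.rpow_neg two_pos.le,
    ← Real.inv_rpow two_pos.le]
  norm_num

lemma hasCouplingLE_of_moment (hp : 1 ≤ p) (hmom : Integrable (fun x => ‖x‖ ^ (2 * p)) μ)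
    (γ : Measure E) [IsProbabilityMeasure γ] :
    HasCouplingLE p (μ ∗ γ) γ
      (ENNReal.ofReal (((∫ x, ‖x‖ ^ (2 * p) ∂μ) ^ (1 / p)) ^ (1 / 2 : ℝ))) := by
  have hm := memLp_of_integrable_norm_rpow hp hmom
  refine ⟨(μ.prod γ).map fun q => (q.1 + q.2, q.2), ⟨?_, ?_⟩, ?_⟩
  · rw [Measure.map_map (by fun_prop) (by fun_prop)]
    rfl
  · rw [Measure.map_map (by fun_prop) (by fun_prop)]
    exact Measure.map_snd_prod.trans (by simp)
  · rw [eLpNorm_map_measure (by fun_prop) (by fun_prop)]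
    have h1 : (fun z : E × E => z.1 - z.2) ∘ (fun q : E × E => (q.1 + q.2, q.2)) =
        (fun x : E => x) ∘ Prod.fst := by
      funext q
      simp
    have hfst : (μ.prod γ).map Prod.fst = μ := Measure.map_fst_prod.trans (by simp)
    rw [h1, ← eLpNorm_map_measure (by fun_prop) (by fun_prop), hfst]
    refine (eLpNorm_le_eLpNorm_of_exponent_le (q := ENNReal.ofReal (2 * p))
      (ENNReal.ofReal_le_ofReal (by linarith)) (by fun_prop)).trans_eq ?_
    have hI : 0 ≤ ∫ x, ‖x‖ ^ (2 * p) ∂μ := integral_nonneg fun q => by positivity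
    rw [hm.eLpNorm_eq_integral_rpow_norm (by simp; linarith) ENNReal.ofReal_ne_top,
      ENNReal.toReal_ofReal (by linarith), ← Real.rpow_mul hI]
    congr 2
    field_simp

end Moments

section Iteration

variable {E : Type*} [NormedAddCommGroup E] [InnerProductSpace ℝ E] [FiniteDimensional ℝ E]
  [MeasurableSpace E] [BorelSpace E] {p : ℝ}

lemma one_sub_two_rpow_mem (hp : 1 ≤ p) :
    0 ≤ 1 - (2 : ℝ) ^ (-(2 * p)) ∧ 1 - (2 : ℝ) ^ (-(2 * p)) < 1 := by
  have h1 : (2 : ℝ) ^ (-(2 * p)) ≤ 1 :=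
    Real.rpow_le_one_of_one_le_of_nonpos one_le_two (by linarith)
  have h2 : 0 < (2 : ℝ) ^ (-(2 * p)) := by positivity
  constructor <;> linarith

lemma hasCouplingLE_iterate (hp : 1 ≤ p) (n : ℕ) :
    ∀ (μ : Measure E) [IsProbabilityMeasure μ], ∫ x, x ∂μ = 0 →
      Integrable (fun x => ‖x‖ ^ (2 * p)) μ →
      HasCouplingLE p (μ ∗ ProbabilityTheory.stdGaussian E) (ProbabilityTheory.stdGaussian E)
        (ENNReal.ofReal (Kconst p *
          (∑ j ∈ Finset.range n, ((1 - (2 : ℝ) ^ (-(2 * p))) ^ (1 / p)) ^ j) *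
            (∫ x, ‖x‖ ^ (2 * p) ∂μ) ^ (1 / p) +
          (((1 - (2 : ℝ) ^ (-(2 * p))) ^ (1 / p)) ^ n *
            (∫ x, ‖x‖ ^ (2 * p) ∂μ) ^ (1 / p)) ^ (1 / 2 : ℝ))) := by
  have hp0 : 0 < p := by linarith
  have hK := one_le_Kconst p
  obtain ⟨hr0, hr1⟩ := one_sub_two_rpow_mem hp
  set r := (1 - (2 : ℝ) ^ (-(2 * p))) ^ (1 / p) with hr
  have hrn : 0 ≤ r := by positivity
  induction n with
  | zero =>
    intro μ _ _ hmom
    simpa using hasCouplingLE_of_moment hp hmom (ProbabilityTheory.stdGaussian E)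
  | succ n ih =>
    intro μ _ hmean hmom
    set S : E × E → E := fun q => (1 / 2 : ℝ) • (q.1 + q.2) with hS
    have hSm : Measurable S := by fun_prop
    have hprob := Measure.isProbabilityMeasure_map (μ := μ.prod μ) hSm.aemeasurable
    have hid := integrable_id_of_integrable_norm_rpow hp hmom
    have hmean' : ∫ x, x ∂(μ.prod μ).map S = 0 := by
      rw [integral_map hSm.aemeasurable (by fun_prop)]
      simp only [hS]
      rw [integral_smul, integral_add (hid.comp_fst μ) (hid.comp_snd μ),
        integral_fun_fst (fun x : E => x), integral_fun_snd (fun x : E => x), hmean]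
      simp
    have hmom' : Integrable (fun x => ‖x‖ ^ (2 * p)) ((μ.prod μ).map S) := by
      rw [integrable_map_measure (Measurable.aestronglyMeasurable (by fun_prop)) hSm.aemeasurable]
      exact integrable_half_add_norm_rpow hp hmom
    have hint' : ∫ x, ‖x‖ ^ (2 * p) ∂(μ.prod μ).map S =
        ∫ q : E × E, ‖(1 / 2 : ℝ) • (q.1 + q.2)‖ ^ (2 * p) ∂μ.prod μ :=
      integral_map hSm.aemeasurable (Measurable.aestronglyMeasurable (by fun_prop))
    have hstep := hasCouplingLE_midpoint hp μ (integrable_half_sub_norm_rpow hp hmom)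
    have hrest := ih ((μ.prod μ).map S) hmean' hmom'
    have hsum := integral_half_add_add_half_sub_le hp hmom
    have hlow := le_integral_half_sub hp hmean hmom
    rw [hint'] at hrest
    set M := ∫ x, ‖x‖ ^ (2 * p) ∂μ with hM
    set A := ∫ q : E × E, ‖(1 / 2 : ℝ) • (q.1 + q.2)‖ ^ (2 * p) ∂μ.prod μ with hA
    set D := ∫ q : E × E, ‖(1 / 2 : ℝ) • (q.1 - q.2)‖ ^ (2 * p) ∂μ.prod μ with hD
    have hM0 : 0 ≤ M := integral_nonneg fun _ => by positivity
    have hA0 : 0 ≤ A := integral_nonneg fun _ => by positivity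
    have hD0 : 0 ≤ D := integral_nonneg fun _ => by positivity
    have hAm : A ^ (1 / p) ≤ r * M ^ (1 / p) := by
      rw [hr, ← Real.mul_rpow hr0 hM0]
      exact Real.rpow_le_rpow hA0 (by linarith) (by positivity)
    have hDm : D ^ (1 / p) ≤ M ^ (1 / p) :=
      Real.rpow_le_rpow hD0 (by linarith) (by positivity)
    refine (hstep.trans hp hrest).mono ?_
    have hs0 : 0 ≤ ∑ j ∈ Finset.range n, r ^ j := Finset.sum_nonneg fun j _ => by positivity
    rw [← ENNReal.ofReal_add (by positivity) (by positivity)]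
    refine ENNReal.ofReal_le_ofReal ?_
    have h1 : Kconst p * D ^ (1 / p) ≤ Kconst p * M ^ (1 / p) := by gcongr
    have h2 : Kconst p * (∑ j ∈ Finset.range n, r ^ j) * A ^ (1 / p) ≤
        Kconst p * (∑ j ∈ Finset.range n, r ^ j) * (r * M ^ (1 / p)) := by gcongr
    have h3 : (r ^ n * A ^ (1 / p)) ^ (1 / 2 : ℝ) ≤
        (r ^ (n + 1) * M ^ (1 / p)) ^ (1 / 2 : ℝ) := by
      rw [pow_succ, mul_assoc]
      gcongr
    have h4 : ∑ j ∈ Finset.range (n + 1), r ^ j = r * ∑ j ∈ Finset.range n, r ^ j + 1 :=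
      geom_sum_succ
    rw [h4]
    linarith

lemma Wp_conv_stdGaussian_le (hp : 1 ≤ p) (μ : Measure E) [IsProbabilityMeasure μ]
    (hmean : ∫ x, x ∂μ = 0) (hmom : Integrable (fun x => ‖x‖ ^ (2 * p)) μ) :
    Wp p (μ ∗ ProbabilityTheory.stdGaussian E) (ProbabilityTheory.stdGaussian E) ≤
      ENNReal.ofReal
        ((Kconst p / (1 - (1 - (2 : ℝ) ^ (-(2 * p))) ^ (1 / p))) *
          (∫ x, ‖x‖ ^ (2 * p) ∂μ) ^ (1 / p)) := by
  have hp0 : 0 < p := by linarith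
  have hle (n : ℕ) := (hasCouplingLE_iterate hp n μ hmean hmom).Wp_le hp0
  obtain ⟨hr0, hr1⟩ := one_sub_two_rpow_mem hp
  set r := (1 - (2 : ℝ) ^ (-(2 * p))) ^ (1 / p) with hr
  have hrn : 0 ≤ r := by positivity
  have hrlt : r < 1 := Real.rpow_lt_one hr0 hr1 (by positivity)
  have h1 := (hasSum_geometric_of_lt_one hrn hrlt).tendsto_sum_nat
  have h2 := (((tendsto_pow_atTop_nhds_zero_of_lt_one hrn hrlt).mul_const
    ((∫ x, ‖x‖ ^ (2 * p) ∂μ) ^ (1 / p))).rpow_const (p := (1 / 2 : ℝ)) (Or.inr (by norm_num)))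
  have h3 := ((h1.const_mul (Kconst p)).mul_const ((∫ x, ‖x‖ ^ (2 * p) ∂μ) ^ (1 / p))).add h2
  rw [zero_mul, Real.zero_rpow (by norm_num), add_zero, ← div_eq_mul_inv] at h3
  exact ge_of_tendsto' ((ENNReal.continuous_ofReal.tendsto _).comp h3) hle

end Iteration

lemma stdGaussian_eq_stdGaussian_euclideanSpace (d : ℕ) :
    stdGaussian d = ProbabilityTheory.stdGaussian (EuclideanSpace ℝ (Fin d)) :=
  map_pi_eq_stdGaussian

/-- first-order Gaussian convolution inequality in `W_p` for centred measures. -/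
theorem wasserstein_gaussian_convolution_general
    (d : ℕ) (hd : 1 ≤ d) (p : ℝ) (hp : 1 ≤ p)
    (μ : Measure (EuclideanSpace ℝ (Fin d))) [IsProbabilityMeasure μ]
    (hmean : ∫ x, x ∂μ = 0)
    (hmom : Integrable (fun x => ‖x‖ ^ (2 * p)) μ) :
    Wp p (μ ∗ stdGaussian d) (stdGaussian d) ≤
      ENNReal.ofReal
        ((Kconst p / (1 - (1 - (2 : ℝ) ^ (-(2 * p))) ^ (1 / p))) *
          (∫ x, ‖x‖ ^ (2 * p) ∂μ) ^ (1 / p)) := by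
  rw [_root_.stdGaussian_eq_stdGaussian_euclideanSpace]
  exact Wp_conv_stdGaussian_le hp μ hmean hmom

end
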